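/- Let μ and ν be strictly positive probability distributions on {−1,1}^n whose single-variable conditionals are close on average in the sense of the conclusion of the closeness-of-conditionals theorem: Σ_{u=1}^n Σ_σ ν(σ) |ν(·|σ_{∖u}) − μ(·|σ_{∖u})|_TV ≤ η/ω_P. Then for any fixed coordinate i and any function F : {−1,1}^{n−1} → ℝ, the conditional variances of σ_i under μ and ν are close on average: E_{σ∼ν} | F(σ_{∖i}) ( Var_{σ_i∼μ(·|σ_{∖i})}[σ_i] − Var_{σ_i∼ν(·|σ_{∖i})}[σ_i] ) | ≤ (4η/ω_P) · max_{x∈{−1,1}^{n−1}} |F(x)|. -/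

import Mathlib

open Finset

/-- The real spin value `±1` of a Boolean spin. -/
noncomputable def spin (b : Bool) : ℝ := if b then 1 else -1

/-- Single-variable conditional `ν(q | σ_{∖i})` for a distribution on `{−1,1}^n`. -/
noncomputable def boolCond {n : ℕ} (ν : (Fin n → Bool) → ℝ) (σ : Fin n → Bool)
    (i : Fin n) (q : Bool) : ℝ :=
  ν (Function.update σ i q) / (ν (Function.update σ i true) + ν (Function.update σ i false))

/-- Conditional variance `Var_{σ_i ∼ ν(·|σ_{∖i})}[σ_i]` of the `±1`-valued spin `σ_i`. -/
noncomputable def boolCondVar {n : ℕ} (ν : (Fin n → Bool) → ℝ) (σ : Fin n → Bool)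
    (i : Fin n) : ℝ :=
  ∑ q : Bool, boolCond ν σ i q * (spin q - ∑ r : Bool, boolCond ν σ i r * spin r) ^ 2

theorem boolCond_aux {n : ℕ} (ν : (Fin n → Bool) → ℝ) (hν : ∀ σ, 0 < ν σ)
    (σ : Fin n → Bool) (i : Fin n) :
    0 ≤ boolCond ν σ i true ∧ boolCond ν σ i true ≤ 1 ∧
      boolCond ν σ i false = 1 - boolCond ν σ i true := by
  have h1 := hν (Function.update σ i true)
  have h2 := hν (Function.update σ i false)
  unfold boolCond
  refine ⟨by positivity, ?_, ?_⟩
  · rw [div_le_one (by positivity)]; linarith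
  · field_simp; ring

theorem boolCondVar_diff {n : ℕ} (μ ν : (Fin n → Bool) → ℝ)
    (hμ : ∀ σ, 0 < μ σ) (hν : ∀ σ, 0 < ν σ) (σ : Fin n → Bool) (i : Fin n) :
    |boolCondVar μ σ i - boolCondVar ν σ i| ≤
      4 * ((1 / 2) * ∑ q : Bool, |boolCond ν σ i q - boolCond μ σ i q|) := by
  obtain ⟨a0, a1, a2⟩ := boolCond_aux μ hμ σ i
  obtain ⟨b0, b1, b2⟩ := boolCond_aux ν hν σ i
  unfold boolCondVar
  simp only [Fintype.sum_bool, a2, b2, spin]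
  generalize boolCond μ σ i true = a at *
  generalize boolCond ν σ i true = b at *
  have e : 1 - b - (1 - a) = -(b - a) := by ring
  rw [e, abs_neg]
  have h : |(b - a) * (a + b - 1)| ≤ |b - a| * 1 := by
    rw [abs_mul]
    exact mul_le_mul_of_nonneg_left (abs_le.2 ⟨by linarith, by linarith⟩) (abs_nonneg _)
  have h' : 4 * |(b - a) * (a + b - 1)| ≤ 4 * (1 / 2 * (|b - a| + |b - a|)) := by linarith
  refine le_trans (le_of_eq ?_) h'
  rw [← abs_of_pos (show (0 : ℝ) < 4 by norm_num), ← abs_mul]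
  congr 1
  simp
  ring

/-- **Closeness of conditional variances.** If the single-variable conditionals
of `ν` and `μ` are on average close (`Σ_u E_{σ∼ν} |ν(·|σ_{∖u}) − μ(·|σ_{∖u})|_TV ≤ η/ω_P`),
then for any coordinate `i` and any `F : {−1,1}^{n−1} → ℝ`,
`E_{σ∼ν} |F(σ_{∖i}) (Var_μ[σ_i|σ_{∖i}] − Var_ν[σ_i|σ_{∖i}])| ≤ (4η/ω_P) max_x |F(x)|`. -/
theorem closeness_of_conditional_variances {n : ℕ}
    (μ ν : (Fin n → Bool) → ℝ)
    (hμpos : ∀ σ, 0 < μ σ) (hμ1 : ∑ σ, μ σ = 1)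
    (hνpos : ∀ σ, 0 < ν σ) (hν1 : ∑ σ, ν σ = 1)
    (η ωP : ℝ) (hη : 0 < η) (hωP : 0 < ωP)
    (hclose : ∑ u : Fin n, ∑ σ : Fin n → Bool, ν σ *
        ((1 / 2) * ∑ q : Bool, |boolCond ν σ u q - boolCond μ σ u q|) ≤ η / ωP)
    (i : Fin n) (F : ({v : Fin n // v ≠ i} → Bool) → ℝ) :
    ∑ σ : Fin n → Bool, ν σ *
        |F (fun v => σ v.1) * (boolCondVar μ σ i - boolCondVar ν σ i)|
      ≤ (4 * η / ωP) * ⨆ x : {v : Fin n // v ≠ i} → Bool, |F x| := by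
  have hS : ∀ x, |F x| ≤ ⨆ x : {v : Fin n // v ≠ i} → Bool, |F x| :=
    fun x => le_ciSup (f := fun x => |F x|) (Set.finite_range _).bddAbove x
  have hS0 : 0 ≤ ⨆ x : {v : Fin n // v ≠ i} → Bool, |F x| :=
    (abs_nonneg _).trans (hS (fun _ => true))
  generalize (⨆ x : {v : Fin n // v ≠ i} → Bool, |F x|) = S at *
  have h1 : ∑ σ : Fin n → Bool, ν σ *
        ((1 / 2) * ∑ q : Bool, |boolCond ν σ i q - boolCond μ σ i q|) ≤ η / ωP := by
    refine le_trans ?_ hclose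
    refine Finset.single_le_sum (f := fun u => ∑ σ : Fin n → Bool, ν σ *
        ((1 / 2) * ∑ q : Bool, |boolCond ν σ u q - boolCond μ σ u q|)) ?_ (Finset.mem_univ i)
    intro u _
    refine Finset.sum_nonneg fun σ _ => mul_nonneg (hνpos σ).le ?_
    positivity
  have h2 : ∑ σ : Fin n → Bool, ν σ *
        |F (fun v => σ v.1) * (boolCondVar μ σ i - boolCondVar ν σ i)| ≤
      ∑ σ : Fin n → Bool, (4 * S) * (ν σ *
        ((1 / 2) * ∑ q : Bool, |boolCond ν σ i q - boolCond μ σ i q|)) := by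
    refine Finset.sum_le_sum fun σ _ => ?_
    rw [abs_mul]
    have h3 := mul_le_mul (hS (fun v => σ v.1)) (boolCondVar_diff μ ν hμpos hνpos σ i)
      (abs_nonneg _) hS0
    have h4 := mul_le_mul_of_nonneg_left h3 (hνpos σ).le
    refine h4.trans (le_of_eq (by ring))
  rw [← Finset.mul_sum] at h2
  have h5 := mul_le_mul_of_nonneg_left h1 (show 0 ≤ 4 * S by positivity)
  refine (h2.trans h5).trans (le_of_eq (by ring))
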